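/- Let p, q, r : ℝ⁴ → ℝ be smooth functions satisfying the coordinate self-duality system ∂₂²p = 0, ∂₃²q = 0, ∂₂²r + ∂₂∂₃p = 0, ∂₃²r + ∂₂∂₃q = 0, ∂₃²p + ∂₂²q + 4∂₂∂₃r = 0 at every point, and define the spin connection coefficients a₀ = −½∂₃p, a₁ = −½∂₂p − ∂₃r, b₀ = ½∂₂p, b₁ = −½∂₃q, d₀ = ½∂₃q + ∂₂r, d₁ = ½∂₂q. Then the following are equivalent at every point: (i) [the foliation is basic] ∂ᵢb_k = 0 and ∂ᵢ(a_k − d_k) = 0 for all i ∈ {2,3} and k ∈ {0,1}; (ii) [the foliation is self-dual] ∂₂(a₀ + d₀) = 0, ∂₃(a₁ + d₁) = 0, and ∂₂(a₁ + d₁) + ∂₃(a₀ + d₀) = 0. (Both are furthermore equivalent to: ∂₂∂₃p = ∂₂∂₃q = 0 and ∂₃²p = ∂₂²q.) -/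

import Mathlib

noncomputable section

/-- Partial derivative `∂ᵢ f` of a function on `ℝ⁴`. -/
def pd (f : (Fin 4 → ℝ) → ℝ) (i : Fin 4) (x : Fin 4 → ℝ) : ℝ :=
  fderiv ℝ f x (Pi.single i 1)

/-- Spin connection coefficient `a₀ = −½∂₃p`. -/
def a0 (p : (Fin 4 → ℝ) → ℝ) (x : Fin 4 → ℝ) : ℝ := -(1 / 2) * pd p 3 x

/-- Spin connection coefficient `a₁ = −½∂₂p − ∂₃r`. -/
def a1 (p r : (Fin 4 → ℝ) → ℝ) (x : Fin 4 → ℝ) : ℝ := -(1 / 2) * pd p 2 x - pd r 3 x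

/-- Spin connection coefficient `b₀ = ½∂₂p`. -/
def b0 (p : (Fin 4 → ℝ) → ℝ) (x : Fin 4 → ℝ) : ℝ := (1 / 2) * pd p 2 x

/-- Spin connection coefficient `b₁ = −½∂₃q`. -/
def b1 (q : (Fin 4 → ℝ) → ℝ) (x : Fin 4 → ℝ) : ℝ := -(1 / 2) * pd q 3 x

/-- Spin connection coefficient `d₀ = ½∂₃q + ∂₂r`. -/
def d0 (q r : (Fin 4 → ℝ) → ℝ) (x : Fin 4 → ℝ) : ℝ := (1 / 2) * pd q 3 x + pd r 2 x

/-- Spin connection coefficient `d₁ = ½∂₂q`. -/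
def d1 (q : (Fin 4 → ℝ) → ℝ) (x : Fin 4 → ℝ) : ℝ := (1 / 2) * pd q 2 x

theorem differentiable_pd {f : (Fin 4 → ℝ) → ℝ} (hf : ContDiff ℝ 2 f) (i : Fin 4) :
    Differentiable ℝ (pd f i) := by
  have h : ContDiff ℝ 1 (fderiv ℝ f) := hf.fderiv_right one_add_one_eq_two.le
  exact (h.differentiable one_ne_zero).clm_apply (differentiable_const _)

theorem pd_comm {f : (Fin 4 → ℝ) → ℝ} (hf : ContDiff ℝ 2 f) (i j : Fin 4)
    (x : Fin 4 → ℝ) : pd (pd f i) j x = pd (pd f j) i x := by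
  have h : ContDiff ℝ 1 (fderiv ℝ f) := hf.fderiv_right one_add_one_eq_two.le
  have key : ∀ k l : Fin 4, pd (pd f k) l x =
      fderiv ℝ (fderiv ℝ f) x (Pi.single l 1) (Pi.single k 1) := by
    intro k l
    have := (((h.differentiable one_ne_zero) x).hasFDerivAt.clm_apply
      (hasFDerivAt_const (Pi.single k (1 : ℝ) : Fin 4 → ℝ) x)).fderiv
    change fderiv ℝ (fun y => fderiv ℝ f y (Pi.single k 1)) x (Pi.single l 1) = _
    rw [this]
    simp
  have hsymm : IsSymmSndFDerivAt ℝ f x :=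
    hf.contDiffAt.isSymmSndFDerivAt (by rw [minSmoothness_of_isRCLikeNormedField])
  rw [key, key, hsymm]

theorem pd_add {f g : (Fin 4 → ℝ) → ℝ} (hf : Differentiable ℝ f) (hg : Differentiable ℝ g)
    (i : Fin 4) (x : Fin 4 → ℝ) : pd (fun y => f y + g y) i x = pd f i x + pd g i x := by
  simp [pd, fderiv_fun_add (hf x) (hg x)]

theorem pd_sub {f g : (Fin 4 → ℝ) → ℝ} (hf : Differentiable ℝ f) (hg : Differentiable ℝ g)
    (i : Fin 4) (x : Fin 4 → ℝ) : pd (fun y => f y - g y) i x = pd f i x - pd g i x := by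
  simp [pd, fderiv_fun_sub (hf x) (hg x)]

theorem pd_const_mul {f : (Fin 4 → ℝ) → ℝ} (hf : Differentiable ℝ f) (c : ℝ)
    (i : Fin 4) (x : Fin 4 → ℝ) : pd (fun y => c * f y) i x = c * pd f i x := by
  simp [pd, fderiv_const_mul (hf x) c]

/-- For a self-dual metric `G(p,q,r)`, at every point the following are equivalent:
(i) the foliation is basic (`∂ᵢb_k = 0`, `∂ᵢ(a_k − d_k) = 0` for `i ∈ {2,3}`, `k ∈ {0,1}`);
(ii) the foliation is self-dual (`∂₂(a₀+d₀) = 0`, `∂₃(a₁+d₁) = 0`,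
`∂₂(a₁+d₁) + ∂₃(a₀+d₀) = 0`); equivalently (iii) `∂₂∂₃p = ∂₂∂₃q = 0` and `∂₃²p = ∂₂²q`. -/
theorem stmt17 (p q r : (Fin 4 → ℝ) → ℝ)
    (hp : ContDiff ℝ (⊤ : ℕ∞) p) (hq : ContDiff ℝ (⊤ : ℕ∞) q) (hr : ContDiff ℝ (⊤ : ℕ∞) r)
    (hsd : ∀ x : Fin 4 → ℝ,
      pd (pd p 2) 2 x = 0 ∧
      pd (pd q 3) 3 x = 0 ∧
      pd (pd r 2) 2 x + pd (pd p 3) 2 x = 0 ∧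
      pd (pd r 3) 3 x + pd (pd q 3) 2 x = 0 ∧
      pd (pd p 3) 3 x + pd (pd q 2) 2 x + 4 * pd (pd r 3) 2 x = 0) :
    ∀ x : Fin 4 → ℝ,
      ((∀ i ∈ ({2, 3} : Set (Fin 4)),
          pd (b0 p) i x = 0 ∧ pd (b1 q) i x = 0 ∧
          pd (fun y => a0 p y - d0 q r y) i x = 0 ∧
          pd (fun y => a1 p r y - d1 q y) i x = 0) ↔
        (pd (fun y => a0 p y + d0 q r y) 2 x = 0 ∧
          pd (fun y => a1 p r y + d1 q y) 3 x = 0 ∧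
          pd (fun y => a1 p r y + d1 q y) 2 x + pd (fun y => a0 p y + d0 q r y) 3 x = 0)) ∧
      ((∀ i ∈ ({2, 3} : Set (Fin 4)),
          pd (b0 p) i x = 0 ∧ pd (b1 q) i x = 0 ∧
          pd (fun y => a0 p y - d0 q r y) i x = 0 ∧
          pd (fun y => a1 p r y - d1 q y) i x = 0) ↔
        (pd (pd p 3) 2 x = 0 ∧ pd (pd q 3) 2 x = 0 ∧
          pd (pd p 3) 3 x = pd (pd q 2) 2 x)) := by
  intro x
  obtain ⟨h1, h2, h3, h4, h5⟩ := hsd x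
  replace hp : ContDiff ℝ 2 p := contDiff_infty.1 hp 2
  replace hq : ContDiff ℝ 2 q := contDiff_infty.1 hq 2
  replace hr : ContDiff ℝ 2 r := contDiff_infty.1 hr 2
  have dp := differentiable_pd hp
  have dq := differentiable_pd hq
  have dr := differentiable_pd hr
  have da0 : Differentiable ℝ (a0 p) := (dp 3).const_mul _
  have da1 : Differentiable ℝ (a1 p r) := ((dp 2).const_mul _).sub (dr 3)
  have dd0 : Differentiable ℝ (d0 q r) := ((dq 3).const_mul _).add (dr 2)
  have dd1 : Differentiable ℝ (d1 q) := (dq 2).const_mul _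
  have eb0 i : pd (b0 p) i x = 1 / 2 * pd (pd p 2) i x := pd_const_mul (dp 2) _ i x
  have eb1 i : pd (b1 q) i x = -(1 / 2) * pd (pd q 3) i x := pd_const_mul (dq 3) _ i x
  have ea0 i : pd (a0 p) i x = -(1 / 2) * pd (pd p 3) i x := pd_const_mul (dp 3) _ i x
  have ed1 i : pd (d1 q) i x = 1 / 2 * pd (pd q 2) i x := pd_const_mul (dq 2) _ i x
  have ea1 i : pd (a1 p r) i x = -(1 / 2) * pd (pd p 2) i x - pd (pd r 3) i x :=
    (pd_sub ((dp 2).const_mul _) (dr 3) i x).trans (by rw [pd_const_mul (dp 2)])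
  have ed0 i : pd (d0 q r) i x = 1 / 2 * pd (pd q 3) i x + pd (pd r 2) i x :=
    (pd_add ((dq 3).const_mul _) (dr 2) i x).trans (by rw [pd_const_mul (dq 3)])
  have cp := pd_comm hp 2 3 x
  have cq := pd_comm hq 2 3 x
  have cr := pd_comm hr 2 3 x
  simp only [Set.mem_insert_iff, Set.mem_singleton_iff, forall_eq_or_imp, forall_eq,
    pd_sub da0 dd0, pd_sub da1 dd1, pd_add da0 dd0, pd_add da1 dd1,
    eb0, eb1, ea0, ea1, ed0, ed1, cp, cq, cr]
  constructor
  · constructor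
    · rintro ⟨⟨-, _, _, _⟩, _, -, _, _⟩
      refine ⟨?_, ?_, ?_⟩ <;> linarith
    · rintro ⟨_, _, _⟩
      refine ⟨⟨?_, ?_, ?_, ?_⟩, ?_, ?_, ?_, ?_⟩ <;> linarith
  · constructor
    · rintro ⟨⟨-, _, _, _⟩, _, -, _, _⟩
      refine ⟨?_, ?_, ?_⟩ <;> linarith
    · rintro ⟨_, _, _⟩
      refine ⟨⟨?_, ?_, ?_, ?_⟩, ?_, ?_, ?_, ?_⟩ <;> linarith
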